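/- Let k be a field and let P be a finitely generated, cancellative, commutative additive monoid that is sharp (if a + b = 0 in P then a = 0) and saturated (for all a, b ∈ P and every integer n ≥ 1, if there exists c ∈ P with n•a = n•b + c, then there exists d ∈ P with a = b + d). Then the monoid algebra k[P] (i.e. AddMonoidAlgebra k P) is a smooth k-algebra if and only if there exists a natural number r and an isomorphism of additive monoids P ≅ ℕ^r (i.e. P ≃+ (Fin r → ℕ)). -/

import Mathlib

universe u

open MvPolynomial

/-- If a formally smooth algebra is presented as a quotient by an ideal contained in `m ^ 2`,
then this ideal `I` satisfies `I ≤ m * I`. -/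
theorem Algebra.FormallySmooth.ker_le_mul_ker {R S A : Type*} [CommRing R] [CommRing S]
    [CommRing A] [Algebra R S] [Algebra R A] [Algebra.FormallySmooth R A] (φ : S →ₐ[R] A)
    (hφ : Function.Surjective φ) (m : Ideal S) (hm : RingHom.ker φ ≤ m ^ 2) :
    RingHom.ker φ ≤ m * RingHom.ker φ := by
  set I := RingHom.ker φ with hI
  have hIm : I ≤ m := hm.trans (Ideal.pow_le_self two_ne_zero)
  have hker : ∀ a ∈ m * I, φ a = 0 := fun a ha ↦ (Ideal.mul_le_right : m * I ≤ I) ha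
  let g : (S ⧸ m * I) →ₐ[R] A := Ideal.Quotient.liftₐ (m * I) φ hker
  have hgmk (s : S) : g (Ideal.Quotient.mk _ s) = φ s := rfl
  have hg : Function.Surjective g := fun a ↦ by
    obtain ⟨s, rfl⟩ := hφ a
    exact ⟨_, hgmk s⟩
  have hnil : IsNilpotent (RingHom.ker (g : (S ⧸ m * I) →+* A)) := by
    refine ⟨2, ?_⟩
    rw [pow_two, Ideal.zero_eq_bot, eq_bot_iff, Ideal.mul_le]
    intro a ha b hb
    obtain ⟨a, rfl⟩ := Ideal.Quotient.mk_surjective a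
    obtain ⟨b, rfl⟩ := Ideal.Quotient.mk_surjective b
    rw [Ideal.mem_bot, ← map_mul, Ideal.Quotient.eq_zero_iff_mem]
    exact Ideal.mul_mem_mul (hIm ha) hb
  let σ : A →ₐ[R] S ⧸ m * I :=
    Algebra.FormallySmooth.liftOfSurjective (AlgHom.id R A) g hg hnil
  have hσ (s : S) : ∃ i ∈ I, σ (φ s) = Ideal.Quotient.mk _ (s + i) := by
    obtain ⟨t, ht⟩ := Ideal.Quotient.mk_surjective (σ (φ s))
    refine ⟨t - s, ?_, by simp [ht]⟩
    rw [hI, RingHom.mem_ker, map_sub, sub_eq_zero, ← hgmk t, ht]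
    exact Algebra.FormallySmooth.liftOfSurjective_apply (AlgHom.id R A) g hg hnil (φ s)
  have hσm : ∀ s ∈ m ^ 2, σ (φ s) = Ideal.Quotient.mk _ s := by
    intro s hs
    rw [pow_two] at hs
    induction hs using Submodule.mul_induction_on' with
    | mem_mul_mem a ha b hb =>
      obtain ⟨i, hi, hi'⟩ := hσ a
      obtain ⟨j, hj, hj'⟩ := hσ b
      rw [map_mul, map_mul, hi', hj', ← map_mul, Ideal.Quotient.eq]
      have : (a + i) * (b + j) - a * b = a * j + b * i + i * j := by ring
      rw [this]
      exact add_mem (add_mem (Ideal.mul_mem_mul ha hj) (Ideal.mul_mem_mul hb hi))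
        (Ideal.mul_mem_mul (hIm hi) hj)
    | add a _ b _ ha hb => simp only [map_add, ha, hb]
  intro s hs
  rw [← Ideal.Quotient.eq_zero_iff_mem, ← hσm s (hm hs), (RingHom.mem_ker).mp hs, map_zero]

theorem Ideal.eq_bot_of_le_mul_self {S : Type*} [CommRing S] [IsNoetherianRing S] [IsDomain S]
    {m I : Ideal S} (hm : m ≠ ⊤) (h : I ≤ m * I) : I = ⊥ := by
  rw [eq_bot_iff, ← Ideal.iInf_pow_eq_bot_of_isDomain m hm]
  refine le_iInf fun n ↦ ?_
  induction n with
  | zero => simp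
  | succ n ih => exact h.trans (by rw [pow_succ']; exact Ideal.mul_mono_right ih)

theorem Finsupp.exists_eq_single_add {σ : Type*} {v : σ →₀ ℕ} (hv : v ≠ 0) :
    ∃ i w, v = Finsupp.single i 1 + w := by
  obtain ⟨i, hi⟩ := Finsupp.support_nonempty_iff.mpr hv
  exact ⟨i, exists_add_of_le (Finsupp.single_le_iff.mpr
    (Nat.one_le_iff_ne_zero.mpr (Finsupp.mem_support_iff.mp hi)))⟩

/-- A formal sum of irreducible elements of degree at most one is determined by its value. -/
theorem Finsupp.eq_of_linearCombination_addIrreducible_eq {P : Type*} [AddCommMonoid P]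
    [Subsingleton (AddUnits P)] {u v : {p : P // AddIrreducible p} →₀ ℕ} (hu : u.degree < 2)
    (h : Finsupp.linearCombination ℕ Subtype.val u = Finsupp.linearCombination ℕ Subtype.val v) :
    u = v := by
  have key : ∀ v : {p : P // AddIrreducible p} →₀ ℕ,
      Finsupp.linearCombination ℕ Subtype.val v = 0 → v = 0 := by
    intro v hv
    by_contra hne
    obtain ⟨i, w, rfl⟩ := Finsupp.exists_eq_single_add hne
    rw [map_add, Finsupp.linearCombination_single, one_smul] at hv
    exact i.2.not_isAddUnit (IsAddUnit.of_add_eq_zero _ hv)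
  by_cases hu0 : u = 0
  · subst hu0
    exact (key v (by rw [← h, map_zero])).symm
  · obtain ⟨i, w, rfl⟩ := Finsupp.exists_eq_single_add hu0
    obtain rfl : w = 0 := by
      rw [map_add, Finsupp.degree_single] at hu
      exact (Finsupp.degree_eq_zero_iff w).mp (by lia)
    rw [add_zero] at h hu0 ⊢
    have hv : v ≠ 0 := fun hv ↦ hu0 (key _ (by rw [h, hv, map_zero]))
    obtain ⟨j, w, rfl⟩ := Finsupp.exists_eq_single_add hv
    simp only [map_add, Finsupp.linearCombination_single, one_smul] at h
    obtain hj | hw := i.2.isAddUnit_or_isAddUnit h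
    · exact absurd hj j.2.not_isAddUnit
    · have hw0 := isAddUnit_iff_eq_zero.mp hw
      rw [hw0, add_zero] at h
      rw [key w hw0, add_zero, Subtype.ext h]

/-- Let `k` be a field and `P` a finitely generated, cancellative,
commutative additive monoid that is sharp and saturated. Then the monoid algebra
`k[P]` is a smooth `k`-algebra if and only if `P ≅ ℕ^r` for some `r`. -/
theorem monoidAlgebra_smooth_iff_free
    (k : Type u) [Field k] (P : Type u) [AddCancelCommMonoid P] [AddMonoid.FG P]
    (sharp : ∀ a b : P, a + b = 0 → a = 0)
    (saturated : ∀ a b : P, ∀ n : ℕ, 1 ≤ n →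
      (∃ c : P, n • a = n • b + c) → ∃ d : P, a = b + d) :
    Algebra.Smooth k (AddMonoidAlgebra k P) ↔
      ∃ r : ℕ, Nonempty (P ≃+ (Fin r → ℕ)) := by
  constructor
  · intro _
    have : Subsingleton (AddUnits P) :=
      ⟨fun a b ↦ AddUnits.ext ((sharp _ _ a.add_neg).trans (sharp _ _ b.add_neg).symm)⟩
    let ι := {p : P // AddIrreducible p}
    have : Finite ι := finite_addIrreducible (M := P)
    let π : (ι →₀ ℕ) →+ P := (Finsupp.linearCombination ℕ Subtype.val).toAddMonoidHom
    have hπ : Function.Surjective π := by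
      rw [← AddMonoidHom.mrange_eq_top, eq_top_iff, ← AddSubmonoid.closure_addIrreducible,
        AddSubmonoid.closure_le]
      intro p hp
      exact ⟨Finsupp.single ⟨p, hp⟩ 1, by simp [π]⟩
    let φ : MvPolynomial ι k →ₐ[k] AddMonoidAlgebra k P := AddMonoidAlgebra.mapDomainAlgHom k k π
    have hφmon (u : ι →₀ ℕ) (c : k) : φ (monomial u c) = AddMonoidAlgebra.single (π u) c :=
      AddMonoidAlgebra.mapDomain_single
    have hφ : Function.Surjective φ := by
      intro x
      induction x using AddMonoidAlgebra.induction_linear with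
      | zero => exact ⟨0, map_zero φ⟩
      | add x y hx hy =>
        obtain ⟨x, rfl⟩ := hx
        obtain ⟨y, rfl⟩ := hy
        exact ⟨x + y, map_add φ x y⟩
      | single p c =>
        obtain ⟨u, rfl⟩ := hπ p
        exact ⟨monomial u c, hφmon u c⟩
    have hker : RingHom.ker φ ≤ idealOfVars ι k ^ 2 := by
      intro f hf
      rw [mem_pow_idealOfVars_iff']
      intro u hu
      have h0 : (φ f).coeff (π u) = 0 := by rw [(RingHom.mem_ker).mp hf]; simp
      rw [f.as_sum, map_sum, AddMonoidAlgebra.coeff_sum, Finsupp.finsetSum_apply,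
        Finset.sum_eq_single u] at h0
      · simpa [hφmon] using h0
      · intro v _ hvu
        rw [hφmon, AddMonoidAlgebra.coeff_single, Finsupp.single_eq_of_ne]
        exact fun h ↦ hvu (Finsupp.eq_of_linearCombination_addIrreducible_eq hu h).symm
      · intro hu
        simp [notMem_support_iff.mp hu]
    have hbot : RingHom.ker φ = ⊥ := Ideal.eq_bot_of_le_mul_self (by
      rw [Ne, Ideal.eq_top_iff_one, ← pow_one (idealOfVars ι k), ← C_1, C_mem_pow_idealOfVars_iff]
      simp) (Algebra.FormallySmooth.ker_le_mul_ker φ hφ _ hker)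
    have hinj : Function.Injective π := by
      intro u v huv
      have : φ (monomial u 1) = φ (monomial v 1) := by rw [hφmon, hφmon, huv]
      exact monomial_left_injective one_ne_zero ((RingHom.injective_iff_ker_eq_bot _).mpr hbot this)
    obtain ⟨r, ⟨e⟩⟩ := Finite.exists_equiv_fin ι
    exact ⟨r, ⟨(AddEquiv.ofBijective π ⟨hinj, hπ⟩).symm.trans
      ((Finsupp.domCongr e).trans (Finsupp.linearEquivFunOnFinite ℕ ℕ (Fin r)).toAddEquiv)⟩⟩
  · rintro ⟨r, ⟨e⟩⟩
    let e' : P ≃+ (Fin r →₀ ℕ) :=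
      e.trans (Finsupp.linearEquivFunOnFinite ℕ ℕ (Fin r)).symm.toAddEquiv
    let E : MvPolynomial (Fin r) k ≃ₐ[k] AddMonoidAlgebra k P :=
      (AddMonoidAlgebra.domCongr k k e').symm
    have : Algebra.Smooth k (MvPolynomial (Fin r) k) := ⟨inferInstance, inferInstance⟩
    exact Algebra.Smooth.of_equiv E
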